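/- For k = 3, the bilinear form B(f,g) = Res(fg) on A is invariant with respect to the contact bracket: Res({f,g}_{k.b.} · h) = Res(f · {g,h}_{k.b.}) for all f, g, h ∈ A. (This is the invariant nondegenerate even supersymmetric bilinear form on the Lie superalgebra k^L(1|6).) -/

import Mathlib

/-!
We model the exterior (Grassmann) algebra `Λ` on `n` anticommuting generators over `ℂ`
concretely as the space of functions `Finset (Fin n) → ℂ` (coordinates with respect to the
monomial basis indexed by subsets of the generators, the generators being ordered by their
index).  For `2k` generators the first `k` indices are `ξ_1, …, ξ_k` and the last `k`
indices are `η_1, …, η_k`.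
-/

noncomputable section

/-- The Grassmann algebra on `n` generators: coordinates w.r.t. the basis of monomials
`θ_S = θ_{i_1}⋯θ_{i_r}` (`S = {i_1 < … < i_r}`). -/
abbrev Lam (n : ℕ) := Finset (Fin n) → ℂ

/-- Koszul sign of the multiplication `θ_S · θ_T` for disjoint `S`, `T`:
`(−1)^(number of pairs (s,t) ∈ S × T with t < s)`. -/
def ksign {n : ℕ} (S T : Finset (Fin n)) : ℂ :=
  (-1 : ℂ) ^ (∑ s ∈ S, (T.filter (fun t => t < s)).card)

/-- The (super)product on the Grassmann algebra `Lam n`: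
`θ_S · θ_T = ksign S T · θ_{S ∪ T}` for disjoint `S`, `T`, zero otherwise,
extended bilinearly. -/
def gmul {n : ℕ} (f g : Lam n) : Lam n :=
  fun U => ∑ S ∈ U.powerset, ksign S (U \ S) * f S * g (U \ S)

/-- The identity element `1` of the Grassmann algebra. -/
def oneLam {n : ℕ} : Lam n := fun S => if S = ∅ then 1 else 0

/-- `f` is homogeneous of `ℤ`-degree `d` (the parity `p f` is `d % 2`). -/
def IsHomog {n : ℕ} (d : ℕ) (f : Lam n) : Prop := ∀ S, f S ≠ 0 → S.card = d

/-- The odd derivation `∂_{θ_i}` of the Grassmann algebra: the unique odd derivation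
sending the generator `θ_i` to `1` and all other generators to `0`.  On monomials:
`∂_{θ_i} θ_T = (−1)^{#{j ∈ T : j < i}} θ_{T \ {i}}` if `i ∈ T`, and `0` otherwise. -/
def pd {n : ℕ} (i : Fin n) (f : Lam n) : Lam n :=
  fun S => if i ∈ S then 0 else ((-1 : ℂ) ^ (S.filter (fun j => j < i)).card) * f (insert i S)

/-- The operator multiplying each monomial of degree `d` by `−(−1)^d`; on a homogeneous
element `f` this is multiplication by `−(−1)^{p(f)}`.  It is used to extend the Poisson
bracket from homogeneous elements bilinearly. -/
def sgnF {n : ℕ} (f : Lam n) : Lam n :=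
  fun S => (-(-1 : ℂ) ^ S.card) * f S

/-- The index of the generator `ξ_j` among the `2k` generators. -/
def xIdx {k : ℕ} (j : Fin k) : Fin (2 * k) := ⟨j.1, by have := j.2; omega⟩

/-- The index of the generator `η_j` among the `2k` generators. -/
def yIdx {k : ℕ} (j : Fin k) : Fin (2 * k) := ⟨k + j.1, by have := j.2; omega⟩

/-- The Poisson bracket on `Lam (2k)`:
`{f,g} = −(−1)^{p(f)} ∑_{j=1}^{k} (∂_{ξ_j}f · ∂_{η_j}g + ∂_{η_j}f · ∂_{ξ_j}g)`
for homogeneous `f`, extended bilinearly (via `sgnF`).  `Lam (2k)` with this bracket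
is the Poisson superalgebra `po(0|2k)`. -/
def pbr {k : ℕ} (f g : Lam (2 * k)) : Lam (2 * k) :=
  ∑ j : Fin k,
    (gmul (pd (xIdx j) (sgnF f)) (pd (yIdx j) g) +
     gmul (pd (yIdx j) (sgnF f)) (pd (xIdx j) g))

/-- The Berezin integral `∫ f vol(θ)`: the coefficient of the top monomial
`ξ_1⋯ξ_k η_1⋯η_k`. -/
def berez {n : ℕ} (f : Lam n) : ℂ := f Finset.univ

/-- The bilinear form `B(f,g) = ∫ fg vol(θ)` on the Grassmann algebra. -/
def Bform {n : ℕ} (f g : Lam n) : ℂ := berez (gmul f g)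

end

/-!
The Laurent/loop level: `A = ℂ[t,t⁻¹] ⊗ Λ`, modelled as finitely supported functions
`ℤ →₀ Lam n` (the value at `m` is the coefficient of `t^m`).
-/

noncomputable section

/-- `ℂ[t,t⁻¹] ⊗ Λ`: Laurent polynomials in the even variable `t` with coefficients
in the Grassmann algebra `Lam n`. -/
abbrev LoopLam (n : ℕ) := ℤ →₀ Lam n

/-- The product on `LoopLam n`: `(t^m ⊗ x)(t^p ⊗ y) = t^{m+p} ⊗ (x·y)`. -/
def tmul {n : ℕ} (f g : LoopLam n) : LoopLam n :=
  f.sum fun m x => g.sum fun p y => Finsupp.single (m + p) (gmul x y)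

/-- Differentiation `∂_t` in the even variable `t`. -/
def dt {n : ℕ} (f : LoopLam n) : LoopLam n :=
  f.sum fun m x => Finsupp.single (m - 1) ((m : ℂ) • x)

/-- The Euler operator `E`: on `t^a ⊗ w` with `w` of Grassmann degree `d` it acts
as multiplication by `d`. -/
def euler {n : ℕ} (f : LoopLam n) : LoopLam n :=
  f.sum fun m x => Finsupp.single m (fun S => (S.card : ℂ) * x S)

/-- The Poisson bracket extended `ℂ[t,t⁻¹]`-bilinearly to `LoopLam (2k)`. -/
def pbrL {k : ℕ} (f g : LoopLam (2 * k)) : LoopLam (2 * k) :=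
  f.sum fun m x => g.sum fun p y => Finsupp.single (m + p) (pbr x y)

/-- The contact bracket
`{f,g}_{k.b.} = (2−E)(f)·∂_t(g) − ∂_t(f)·(2−E)(g) − {f,g}_{P.b.}` on `LoopLam (2k)`;
this is the Lie superalgebra `k^L(1|2k)` in its generating-functions realization. -/
def kbr {k : ℕ} (f g : LoopLam (2 * k)) : LoopLam (2 * k) :=
  tmul ((2 : ℂ) • f - euler f) (dt g) - tmul (dt f) ((2 : ℂ) • g - euler g) - pbrL f g

/-- `f ∈ LoopLam n` is homogeneous of Grassmann degree `d` (its parity is `d % 2`). -/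
def IsHomogL {n : ℕ} (d : ℕ) (f : LoopLam n) : Prop :=
  ∀ (m : ℤ) (S : Finset (Fin n)), f m S ≠ 0 → S.card = d

end

noncomputable section

/-- `Res f`: the coefficient of `(1/t)·θ_1⋯θ_n` (the top Grassmann monomial over `t^{-1}`)
in the expansion of `f` in the monomial basis. -/
def ResL {n : ℕ} (f : LoopLam n) : ℂ := f (-1) Finset.univ

/-- The bilinear form `B(f,g) = Res (fg)` on `ℂ[t,t⁻¹] ⊗ Λ`. -/
def BRes {n : ℕ} (f g : LoopLam n) : ℂ := ResL (tmul f g)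

/-- The 2-cocycle `c(t^m ⊗ f, t^n ⊗ g) = δ_{m+n,0} · m · ∫ fg vol(θ)` on the loop
Poisson superalgebra, extended bilinearly. -/
def cocyc {n : ℕ} (f g : LoopLam n) : ℂ :=
  f.sum fun m x => (m : ℂ) * berez (gmul x (g (-m)))

/-- The bilinear form `B⁽¹⁾(t^m ⊗ f, t^n ⊗ g) = δ_{m+n,0} · ∫ fg vol(θ)` on the loop
algebra, extended bilinearly. -/
def Bloop {n : ℕ} (f g : LoopLam n) : ℂ :=
  f.sum fun m x => berez (gmul x (g (-m)))

end

noncomputable section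

theorem gmul_add_left {n : ℕ} (f f' g : Lam n) : gmul (f + f') g = gmul f g + gmul f' g := by
  funext U; simp only [gmul, Pi.add_apply, ← Finset.sum_add_distrib]
  exact Finset.sum_congr rfl fun _ _ => by ring

theorem gmul_add_right {n : ℕ} (f g g' : Lam n) : gmul f (g + g') = gmul f g + gmul f g' := by
  funext U; simp only [gmul, Pi.add_apply, ← Finset.sum_add_distrib]
  exact Finset.sum_congr rfl fun _ _ => by ring

theorem gmul_smul_left {n : ℕ} (c : ℂ) (f g : Lam n) : gmul (c • f) g = c • gmul f g := by
  funext U; simp only [gmul, Pi.smul_apply, smul_eq_mul, Finset.mul_sum]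
  exact Finset.sum_congr rfl fun _ _ => by ring

theorem gmul_smul_right {n : ℕ} (c : ℂ) (f g : Lam n) : gmul f (c • g) = c • gmul f g := by
  funext U; simp only [gmul, Pi.smul_apply, smul_eq_mul, Finset.mul_sum]
  exact Finset.sum_congr rfl fun _ _ => by ring

def gL (n : ℕ) : Lam n →ₗ[ℂ] Lam n →ₗ[ℂ] Lam n :=
  LinearMap.mk₂ ℂ gmul gmul_add_left gmul_smul_left gmul_add_right gmul_smul_right

theorem gL_apply {n : ℕ} (f g : Lam n) : gL n f g = gmul f g := rfl

def pdL {n : ℕ} (i : Fin n) : Lam n →ₗ[ℂ] Lam n where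
  toFun := pd i
  map_add' f g := by funext S; simp only [pd, Pi.add_apply]; split_ifs <;> ring
  map_smul' c f := by
    funext S; simp only [pd, Pi.smul_apply, smul_eq_mul, RingHom.id_apply]; split_ifs <;> ring

theorem pdL_apply {n : ℕ} (i : Fin n) (f : Lam n) : pdL i f = pd i f := rfl

def sL (n : ℕ) : Lam n →ₗ[ℂ] Lam n where
  toFun := sgnF
  map_add' f g := by funext S; simp only [sgnF, Pi.add_apply]; ring
  map_smul' c f := by
    funext S; simp only [sgnF, Pi.smul_apply, smul_eq_mul, RingHom.id_apply]; ring

theorem sL_apply {n : ℕ} (f : Lam n) : sL n f = sgnF f := rfl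

def eL (n : ℕ) : Lam n →ₗ[ℂ] Lam n where
  toFun := fun x S => (S.card : ℂ) * x S
  map_add' f g := by funext S; simp only [Pi.add_apply]; ring
  map_smul' c f := by
    funext S; simp only [Pi.smul_apply, smul_eq_mul, RingHom.id_apply]; ring

theorem ksign_union_left {n : ℕ} {S S' : Finset (Fin n)} (T : Finset (Fin n))
    (h : Disjoint S S') : ksign (S ∪ S') T = ksign S T * ksign S' T := by
  simp only [ksign, Finset.sum_union h, pow_add]

theorem ksign_union_right {n : ℕ} (S : Finset (Fin n)) {T T' : Finset (Fin n)}
    (h : Disjoint T T') : ksign S (T ∪ T') = ksign S T * ksign S T' := by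
  simp only [ksign, ← pow_add, ← Finset.sum_add_distrib]
  congr 1
  refine Finset.sum_congr rfl fun s _ => ?_
  rw [Finset.filter_union, Finset.card_union_of_disjoint]
  exact Finset.disjoint_filter_filter h

theorem ksign_sing {n : ℕ} (i : Fin n) (S : Finset (Fin n)) :
    (-1 : ℂ) ^ (S.filter (fun j => j < i)).card = ksign {i} S := by
  simp [ksign]

theorem ksign_sq {n : ℕ} (S T : Finset (Fin n)) : ksign S T * ksign S T = 1 := by
  simp only [ksign, ← mul_pow]; norm_num

theorem ksign_comm {n : ℕ} (i : Fin n) (S : Finset (Fin n)) (h : i ∉ S) :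
    ksign S {i} = (-1) ^ S.card * ksign {i} S := by
  induction S using Finset.induction_on with
  | empty => simp [ksign]
  | insert a S ha ih =>
    simp only [Finset.mem_insert, not_or] at h
    have hd : Disjoint {a} S := by simpa using ha
    have h1 : ksign ({a} : Finset (Fin n)) {i} = - ksign {i} {a} := by
      rcases lt_or_gt_of_ne h.1 with hl | hl
      · simp [ksign, Finset.filter_singleton, hl, hl.not_gt]
      · simp [ksign, Finset.filter_singleton, hl, hl.not_gt]
    rw [Finset.card_insert_of_notMem ha, Finset.insert_eq, ksign_union_left _ hd,
      ksign_union_right _ hd, ih h.2, h1]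
    ring

theorem gmul_assoc {n : ℕ} (f g h : Lam n) : gmul (gmul f g) h = gmul f (gmul g h) := by
  funext U
  simp only [gmul, Finset.mul_sum, Finset.sum_mul, Finset.sum_sigma']
  refine Finset.sum_bij' (fun p _ => ⟨p.2, p.1 \ p.2⟩) (fun p _ => ⟨p.1 ∪ p.2, p.1⟩) ?_ ?_ ?_ ?_ ?_
  · rintro ⟨S, T⟩ hp
    simp only [Finset.mem_sigma, Finset.mem_powerset] at hp ⊢
    exact ⟨hp.2.trans hp.1, Finset.sdiff_subset_sdiff hp.1 le_rfl⟩
  · rintro ⟨S, T⟩ hp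
    simp only [Finset.mem_sigma, Finset.mem_powerset] at hp ⊢
    exact ⟨Finset.union_subset hp.1 (hp.2.trans Finset.sdiff_subset), Finset.subset_union_left⟩
  · rintro ⟨S, T⟩ hp
    simp only [Finset.mem_sigma, Finset.mem_powerset] at hp
    simp [Finset.union_sdiff_of_subset hp.2]
  · rintro ⟨S, T⟩ hp
    simp only [Finset.mem_sigma, Finset.mem_powerset] at hp
    have : (S ∪ T) \ S = T :=
      Finset.union_sdiff_cancel_left (Finset.disjoint_of_subset_right hp.2 Finset.disjoint_sdiff)
    simp [this]
  · rintro ⟨S, T⟩ hp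
    simp only [Finset.mem_sigma, Finset.mem_powerset] at hp
    obtain ⟨h1, h2⟩ := hp
    have e1 : (U \ T) \ (S \ T) = U \ S := by
      ext x; have := @h2 x; simp only [Finset.mem_sdiff]; tauto
    have e2 : U \ T = (S \ T) ∪ (U \ S) := by
      ext x; have := @h2 x; have := @h1 x
      simp only [Finset.mem_sdiff, Finset.mem_union]; tauto
    have d1 : Disjoint (S \ T) (U \ S) :=
      Finset.disjoint_of_subset_left Finset.sdiff_subset Finset.disjoint_sdiff
    have e3 : ksign S (U \ S) = ksign T (U \ S) * ksign (S \ T) (U \ S) := by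
      rw [← ksign_union_left _ Finset.disjoint_sdiff, Finset.union_sdiff_of_subset h2]
    have e4 : ksign T (U \ T) = ksign T (S \ T) * ksign T (U \ S) := by
      rw [e2, ksign_union_right _ d1]
    simp only [e1, e3, e4]
    ring

theorem pd_gmul {n : ℕ} (i : Fin n) (f g : Lam n) :
    pd i (gmul f g) = gmul (pd i f) g - gmul (sgnF f) (pd i g) := by
  funext U
  by_cases hi : i ∈ U
  · obtain ⟨V, hV, rfl⟩ : ∃ V, i ∉ V ∧ insert i V = U :=
      ⟨U.erase i, Finset.notMem_erase _ _, Finset.insert_erase hi⟩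
    simp only [pd, gmul, Pi.sub_apply, Finset.mem_insert_self, if_true,
      Finset.sum_powerset_insert hV]
    rw [← Finset.sum_add_distrib, ← Finset.sum_add_distrib, ← Finset.sum_sub_distrib]
    symm
    refine Finset.sum_eq_zero fun S hS => ?_
    rw [Finset.mem_powerset] at hS
    have hiS : i ∉ S := fun h => hV (hS h)
    have e1 : insert i V \ S = insert i (V \ S) := Finset.insert_sdiff_of_notMem _ hiS
    have e2 : insert i V \ insert i S = V \ S := by
      ext x; simp only [Finset.mem_sdiff, Finset.mem_insert]
      by_cases hx : x = i
      · subst hx; simp [hV]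
      · simp [hx]
    have hiD : i ∉ V \ S := fun h => hV (Finset.mem_sdiff.1 h).1
    have d1 : Disjoint {i} (V \ S) := by simpa using hiD
    have d2 : Disjoint {i} S := by simpa using hiS
    simp only [e1, e2, hiS, hiD, Finset.mem_insert_self, if_true, if_false, ksign_sing, sgnF,
      Finset.card_insert_of_notMem hiS]
    rw [Finset.insert_eq i S, Finset.insert_eq i (V \ S), ksign_union_right _ d1,
      ksign_union_left _ d2, ksign_comm i S hiS]
    have q1 := ksign_sq {i} S
    have q2 := ksign_sq {i} (V \ S)
    linear_combination ((-1) ^ S.card * ksign S (V \ S) * f ({i} ∪ S) * g ({i} ∪ V \ S)) * (q1 - q2)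
  · have : ∀ S, S ⊆ U → i ∉ S := fun S hS h => hi (hS h)
    simp only [pd, gmul, Pi.sub_apply, hi, if_false,
      Finset.sum_powerset_insert hi]
    rw [← Finset.sum_add_distrib, Finset.mul_sum, ← Finset.sum_sub_distrib]
    refine Finset.sum_congr rfl fun S hS => ?_
    rw [Finset.mem_powerset] at hS
    have hiS : i ∉ S := this S hS
    have e1 : insert i U \ S = insert i (U \ S) := Finset.insert_sdiff_of_notMem _ hiS
    have e2 : insert i U \ insert i S = U \ S := by
      ext x; simp only [Finset.mem_sdiff, Finset.mem_insert]
      by_cases hx : x = i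
      · subst hx; simp [hi]
      · simp [hx]
    have hiD : i ∉ U \ S := fun h => hi (Finset.mem_sdiff.1 h).1
    have d1 : Disjoint {i} (U \ S) := by simpa using hiD
    have d2 : Disjoint {i} S := by simpa using hiS
    have e3 : ksign {i} U = ksign {i} S * ksign {i} (U \ S) := by
      rw [← ksign_union_right _ Finset.disjoint_sdiff, Finset.union_sdiff_of_subset hS]
    simp only [e1, e2, hiS, hiD, if_false, ksign_sing, sgnF]
    rw [Finset.insert_eq i S, Finset.insert_eq i (U \ S), ksign_union_right _ d1,
      ksign_union_left _ d2, ksign_comm i S hiS, e3]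
    have q1 := ksign_sq {i} S
    have q2 := ksign_sq {i} (U \ S)
    linear_combination ((-1) ^ S.card * ksign {i} (U \ S) * ksign S (U \ S) * f S * g ({i} ∪ U \ S)) * q1 +
      (ksign {i} S * ksign S (U \ S) * f ({i} ∪ S) * g (U \ S)) * q2

theorem pd_anti {n : ℕ} (i j : Fin n) (hij : i ≠ j) (f : Lam n) :
    pd i (pd j f) = - pd j (pd i f) := by
  funext S
  simp only [pd, Pi.neg_apply, ksign_sing]
  by_cases h1 : i ∈ S
  · simp [h1]
  by_cases h2 : j ∈ S
  · simp [h2]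
  have d1 : Disjoint {i} S := by simpa using h1
  have d2 : Disjoint {j} S := by simpa using h2
  have k : ksign {i} {j} = - ksign {j} {i} := by
    rw [ksign_comm j {i} (by simpa using hij.symm)]; simp
  simp only [h1, h2, hij, hij.symm, Finset.mem_insert, or_self, if_false]
  rw [Finset.insert_comm j i S, Finset.insert_eq i S, Finset.insert_eq j S,
    ksign_union_right _ d1, ksign_union_right _ d2, k]
  ring

theorem pd_sgnF {n : ℕ} (i : Fin n) (f : Lam n) : pd i (sgnF f) = - sgnF (pd i f) := by
  funext S
  simp only [pd, sgnF, Pi.neg_apply]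
  split_ifs with h
  · simp
  · rw [Finset.card_insert_of_notMem h]; ring

theorem sgnF_sgnF {n : ℕ} (f : Lam n) : sgnF (sgnF f) = f := by
  funext S
  simp only [sgnF]
  have : ((-1 : ℂ) ^ S.card) * (-1) ^ S.card = 1 := by rw [← mul_pow]; norm_num
  linear_combination f S * this

theorem e_gmul {n : ℕ} (f g : Lam n) :
    eL n (gmul f g) = gmul (eL n f) g + gmul f (eL n g) := by
  funext U
  simp only [eL, gmul, LinearMap.coe_mk, AddHom.coe_mk, Pi.add_apply, Finset.mul_sum,
    ← Finset.sum_add_distrib]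
  refine Finset.sum_congr rfl fun S hS => ?_
  rw [Finset.mem_powerset] at hS
  have : (U.card : ℂ) = (U \ S).card + S.card := by
    exact_mod_cast (Finset.card_sdiff_add_card_eq_card hS).symm
  rw [this]; ring

def bL (n : ℕ) : Lam n →ₗ[ℂ] ℂ := LinearMap.proj Finset.univ

theorem b_pd {n : ℕ} (i : Fin n) (f : Lam n) : bL n (pd i f) = 0 := by
  simp [bL, pd]

theorem b_parts {n : ℕ} (i : Fin n) (x u : Lam n) :
    bL n (gmul (pd i (sgnF x)) u) = bL n (gmul x (pd i u)) := by
  have := b_pd i (gmul (sgnF x) u)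
  rw [pd_gmul, sgnF_sgnF, map_sub] at this
  exact sub_eq_zero.1 this

theorem b_pois {n : ℕ} (i j : Fin n) (hij : i ≠ j) (x y z : Lam n) :
    bL n (gmul (gmul (pd i (sgnF x)) (pd j y) + gmul (pd j (sgnF x)) (pd i y)) z) =
    bL n (gmul x (gmul (pd i (sgnF y)) (pd j z) + gmul (pd j (sgnF y)) (pd i z))) := by
  have n1 : ∀ a b : Lam n, gmul (-a) b = - gmul a b := fun a b => by
    simpa using gmul_smul_left (-1) a b
  have n2 : ∀ a b : Lam n, gmul a (-b) = - gmul a b := fun a b => by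
    simpa using gmul_smul_right (-1) a b
  rw [gmul_add_left, gmul_assoc, gmul_assoc, map_add, b_parts, b_parts, pd_gmul, pd_gmul,
    pd_anti i j hij, pd_sgnF, pd_sgnF]
  simp only [sub_eq_add_neg, n1, gmul_add_right, n2, map_add, map_neg]
  ring

def pL (k : ℕ) : Lam (2 * k) →ₗ[ℂ] Lam (2 * k) →ₗ[ℂ] Lam (2 * k) :=
  ∑ j : Fin k, ((gL _).compl₁₂ (pdL (xIdx j) ∘ₗ sL _) (pdL (yIdx j)) +
    (gL _).compl₁₂ (pdL (yIdx j) ∘ₗ sL _) (pdL (xIdx j)))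

theorem pL_apply {k : ℕ} (x y : Lam (2 * k)) : pL k x y = pbr x y := by
  simp only [pL, pbr, LinearMap.sum_apply, LinearMap.add_apply, LinearMap.compl₁₂_apply,
    LinearMap.comp_apply, gL_apply, pdL_apply, sL_apply]

theorem b_pbr {k : ℕ} (x y z : Lam (2 * k)) :
    bL _ (gmul (pbr x y) z) = bL _ (gmul x (pbr y z)) := by
  rw [← gL_apply, ← gL_apply]
  simp only [pbr, map_sum, LinearMap.sum_apply]
  refine Finset.sum_congr rfl fun j _ => ?_
  refine b_pois _ _ ?_ x y z
  intro h
  have h1 : (j : ℕ) = k + j := congrArg Fin.val h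
  have h2 := j.2
  omega

/-- bilinear extension to loops -/
def ext2 {n : ℕ} (B : Lam n →ₗ[ℂ] Lam n →ₗ[ℂ] Lam n) (f g : LoopLam n) : LoopLam n :=
  f.sum fun m x => g.sum fun p y => Finsupp.single (m + p) (B x y)

theorem ext2_add_left {n : ℕ} (B : Lam n →ₗ[ℂ] Lam n →ₗ[ℂ] Lam n) (f f' g : LoopLam n) :
    ext2 B (f + f') g = ext2 B f g + ext2 B f' g := by
  unfold ext2
  refine Finsupp.sum_add_index' (fun m => by simp) fun m x y => ?_
  simp only [map_add, LinearMap.add_apply, Finsupp.single_add, Finsupp.sum_add]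

theorem ext2_add_right {n : ℕ} (B : Lam n →ₗ[ℂ] Lam n →ₗ[ℂ] Lam n) (f g g' : LoopLam n) :
    ext2 B f (g + g') = ext2 B f g + ext2 B f g' := by
  unfold ext2
  rw [← Finsupp.sum_add]
  refine Finsupp.sum_congr fun m _ => ?_
  exact Finsupp.sum_add_index' (fun m => by simp) fun m x y => by simp

theorem ext2_single {n : ℕ} (B : Lam n →ₗ[ℂ] Lam n →ₗ[ℂ] Lam n) (a b : ℤ) (x y : Lam n) :
    ext2 B (Finsupp.single a x) (Finsupp.single b y) = Finsupp.single (a + b) (B x y) := by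
  simp [ext2]

theorem ext2_sub_left {n : ℕ} (B : Lam n →ₗ[ℂ] Lam n →ₗ[ℂ] Lam n) (f f' g : LoopLam n) :
    ext2 B (f - f') g = ext2 B f g - ext2 B f' g := by
  rw [eq_sub_iff_add_eq, ← ext2_add_left, sub_add_cancel]

theorem ext2_sub_right {n : ℕ} (B : Lam n →ₗ[ℂ] Lam n →ₗ[ℂ] Lam n) (f g g' : LoopLam n) :
    ext2 B f (g - g') = ext2 B f g - ext2 B f g' := by
  rw [eq_sub_iff_add_eq, ← ext2_add_right, sub_add_cancel]

theorem tmul_eq {n : ℕ} (f g : LoopLam n) : tmul f g = ext2 (gL n) f g := rfl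

theorem pbrL_eq {k : ℕ} (f g : LoopLam (2 * k)) : pbrL f g = ext2 (pL k) f g := by
  simp only [pbrL, ext2, pL_apply]

theorem dt_add {n : ℕ} (f g : LoopLam n) : dt (f + g) = dt f + dt g :=
  Finsupp.sum_add_index' (fun m => by simp) fun m x y => by simp

theorem dt_single {n : ℕ} (a : ℤ) (x : Lam n) :
    dt (Finsupp.single a x) = Finsupp.single (a - 1) ((a : ℂ) • x) := by simp [dt]

theorem euler_eq {n : ℕ} (f : LoopLam n) :
    euler f = f.sum fun m x => Finsupp.single m (eL n x) := rfl

theorem euler_add {n : ℕ} (f g : LoopLam n) : euler (f + g) = euler f + euler g := by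
  simp only [euler_eq]
  exact Finsupp.sum_add_index' (fun m => by simp) fun m x y => by simp

theorem euler_single {n : ℕ} (a : ℤ) (x : Lam n) :
    euler (Finsupp.single a x) = Finsupp.single a (eL n x) := by simp [euler_eq]

theorem kbr_add_left {k : ℕ} (f f' g : LoopLam (2 * k)) :
    kbr (f + f') g = kbr f g + kbr f' g := by
  simp only [kbr, tmul_eq, pbrL_eq, smul_add, euler_add, dt_add, add_sub_add_comm, ext2_add_left]

theorem kbr_add_right {k : ℕ} (f g g' : LoopLam (2 * k)) :
    kbr f (g + g') = kbr f g + kbr f g' := by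
  simp only [kbr, tmul_eq, pbrL_eq, smul_add, euler_add, dt_add, add_sub_add_comm, ext2_add_right]

theorem BRes_add_left {n : ℕ} (f f' g : LoopLam n) : BRes (f + f') g = BRes f g + BRes f' g := by
  simp [BRes, ResL, tmul_eq, ext2_add_left]

theorem BRes_add_right {n : ℕ} (f g g' : LoopLam n) : BRes f (g + g') = BRes f g + BRes f g' := by
  simp [BRes, ResL, tmul_eq, ext2_add_right]

theorem BRes_sub_left {n : ℕ} (f f' g : LoopLam n) : BRes (f - f') g = BRes f g - BRes f' g := by
  simp [BRes, ResL, tmul_eq, ext2_sub_left]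

theorem BRes_sub_right {n : ℕ} (f g g' : LoopLam n) : BRes f (g - g') = BRes f g - BRes f g' := by
  simp [BRes, ResL, tmul_eq, ext2_sub_right]

theorem BRes_single {n : ℕ} (a b : ℤ) (x y : Lam n) :
    BRes (Finsupp.single a x) (Finsupp.single b y) =
      if a + b = -1 then bL n (gL n x y) else 0 := by
  simp only [BRes, ResL, tmul_eq, ext2_single, Finsupp.single_apply]
  split_ifs <;> rfl

theorem kbr_single {k : ℕ} (a b : ℤ) (x y : Lam (2 * k)) :
    kbr (Finsupp.single a x) (Finsupp.single b y) =
      Finsupp.single (a + (b - 1)) (gL _ ((2 : ℂ) • x - eL _ x) ((b : ℂ) • y)) -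
      Finsupp.single (a - 1 + b) (gL _ ((a : ℂ) • x) ((2 : ℂ) • y - eL _ y)) -
      Finsupp.single (a + b) (pbr x y) := by
  simp only [kbr, tmul_eq, pbrL_eq, euler_single, dt_single, Finsupp.smul_single,
    ← Finsupp.single_sub, ext2_single, pL_apply]

theorem b_e (f : Lam (2 * 3)) : bL _ (eL _ f) = 6 * bL _ f := by
  simp [bL, eL]

theorem BRes_single_inv (a b c : ℤ) (x y z : Lam (2 * 3)) :
    BRes (kbr (Finsupp.single a x) (Finsupp.single b y)) (Finsupp.single c z) =
      BRes (Finsupp.single a x) (kbr (Finsupp.single b y) (Finsupp.single c z)) := by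
  rw [kbr_single, kbr_single]
  simp only [BRes_sub_left, BRes_sub_right, BRes_single]
  have hp := b_pbr x y z
  rw [← gL_apply, ← gL_apply] at hp
  have e1 : (a + (b - 1) + c = -1) ↔ a + b + c = 0 := by omega
  have e2 : (a - 1 + b + c = -1) ↔ a + b + c = 0 := by omega
  have e3 : (a + (b + (c - 1)) = -1) ↔ a + b + c = 0 := by omega
  have e4 : (a + (b - 1 + c) = -1) ↔ a + b + c = 0 := by omega
  simp only [e1, e2, e3, e4]
  simp only [← add_assoc, hp]
  congr 1
  split_ifs with h
  · have hc : (a : ℂ) + b + c = 0 := by exact_mod_cast h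
    have hE := b_e (gmul (gmul x y) z)
    rw [e_gmul, e_gmul, gmul_add_left, gmul_assoc, gmul_assoc, gmul_assoc, gmul_assoc] at hE
    simp only [map_add] at hE
    simp only [map_sub, map_smul, LinearMap.sub_apply, LinearMap.smul_apply, smul_eq_mul,
      gL_apply, gmul_assoc]
    obtain rfl : c = -a - b := by omega
    push_cast
    linear_combination (-(b : ℂ)) * hE
  · rfl

end

/-- For `k = 3`, the bilinear form `B(f,g) = Res(fg)` on `A` is invariant
with respect to the contact bracket: `Res({f,g}_{k.b.}·h) = Res(f·{g,h}_{k.b.})` for all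
`f, g, h ∈ A`.  (This is the invariant nondegenerate even supersymmetric bilinear form on
the Lie superalgebra `k^L(1|6)`.) -/
theorem BRes_invariant (f g h : LoopLam (2 * 3)) :
    BRes (kbr f g) h = BRes f (kbr g h) := by
  induction f using Finsupp.induction_linear with
  | zero =>
    have k0 := kbr_add_left 0 0 g
    have b0 := BRes_add_left 0 0 h
    have b1 := BRes_add_left 0 0 (kbr g h)
    simp only [add_zero, left_eq_add] at k0 b0 b1
    rw [k0, b0, b1]
  | add f f' h1 h2 => rw [kbr_add_left, BRes_add_left, BRes_add_left, h1, h2]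
  | single a x =>
    induction g using Finsupp.induction_linear with
    | zero =>
      have k0 := kbr_add_right (Finsupp.single a x) 0 0
      have k1 := kbr_add_left 0 0 h
      have b0 := BRes_add_left 0 0 h
      have b1 := BRes_add_right (Finsupp.single a x) 0 0
      simp only [add_zero, left_eq_add] at k0 k1 b0 b1
      rw [k0, k1, b0, b1]
    | add f f' h1 h2 =>
      rw [kbr_add_right, kbr_add_left, BRes_add_left, BRes_add_right, h1, h2]
    | single b y =>
      induction h using Finsupp.induction_linear with
      | zero =>
        have k0 := kbr_add_right (Finsupp.single b y) 0 0
        have b0 := BRes_add_right (kbr (Finsupp.single a x) (Finsupp.single b y)) 0 0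
        have b1 := BRes_add_right (Finsupp.single a x) 0 0
        simp only [add_zero, left_eq_add] at k0 b0 b1
        rw [k0, b0, b1]
      | add f f' h1 h2 => rw [kbr_add_right, BRes_add_right, BRes_add_right, h1, h2]
      | single c z => exact BRes_single_inv a b c x y z
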